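/- Let R > 0 and A ∈ ℝ with 2RA ∈ 2ℤ + 1. Then for every ℓ > 0 with sin(2πRℓ) ≠ 0 one has 2ℓ·(cot(2πRℓ) − cos(2πRA)/sin(2πRℓ)) = 2ℓ·cot(πRℓ), so the cylinder spectral condition −α = 2ℓ·(cot(2πRℓ) − cos(2πRA)/sin(2πRℓ)) is equivalent to −α = 2ℓ·cot(πRℓ). Moreover, for every α > −2/(πR) the equation −α = 2ℓ·cot(πRℓ) has a solution ℓ ∈ (0, 1/R), and for every integer n ≥ 2 and every α ∈ ℝ it has a solution ℓ ∈ ((n−1)/R, n/R) with sin(πRℓ) ≠ 0. -/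

import Mathlib

open Real

/-- Half-integer-flux case `2RA ∈ 2ℤ + 1`: the cylinder spectral condition
reduces to `−α = 2ℓ·cot(πRℓ)`, which is solvable in `(0, 1/R)` for every
`α > −2/(πR)` and in `((n−1)/R, n/R)` for every `n ≥ 2` and every `α`. -/
theorem cylinder_spectral_condition_half_integer_flux
    (R A : ℝ) (hR : 0 < R) (hflux : ∃ k : ℤ, 2 * R * A = 2 * (k : ℝ) + 1) :
    (∀ ℓ : ℝ, 0 < ℓ → Real.sin (2 * π * R * ℓ) ≠ 0 →
      2 * ℓ * (Real.cot (2 * π * R * ℓ)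
          - Real.cos (2 * π * R * A) / Real.sin (2 * π * R * ℓ))
        = 2 * ℓ * Real.cot (π * R * ℓ)) ∧
    (∀ α : ℝ, ∀ ℓ : ℝ, 0 < ℓ → Real.sin (2 * π * R * ℓ) ≠ 0 →
      (-α = 2 * ℓ * (Real.cot (2 * π * R * ℓ)
          - Real.cos (2 * π * R * A) / Real.sin (2 * π * R * ℓ)) ↔
        -α = 2 * ℓ * Real.cot (π * R * ℓ))) ∧
    (∀ α : ℝ, -(2 / (π * R)) < α →
      ∃ ℓ ∈ Set.Ioo (0 : ℝ) (1 / R), -α = 2 * ℓ * Real.cot (π * R * ℓ)) ∧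
    (∀ n : ℕ, 2 ≤ n → ∀ α : ℝ,
      ∃ ℓ ∈ Set.Ioo (((n : ℝ) - 1) / R) ((n : ℝ) / R),
        Real.sin (π * R * ℓ) ≠ 0 ∧ -α = 2 * ℓ * Real.cot (π * R * ℓ)) := by
  have h1 : ∀ ℓ : ℝ, 0 < ℓ → Real.sin (2 * π * R * ℓ) ≠ 0 →
      2 * ℓ * (Real.cot (2 * π * R * ℓ)
          - Real.cos (2 * π * R * A) / Real.sin (2 * π * R * ℓ))
        = 2 * ℓ * Real.cot (π * R * ℓ) := by
    intro ℓ _ hs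
    obtain ⟨k, hk⟩ := hflux
    have hc : Real.cos (2 * π * R * A) = -1 := by
      have : 2 * π * R * A = π + k * (2 * π) := by
        linear_combination π * hk
      rw [this, Real.cos_add_int_mul_two_pi, Real.cos_pi]
    have h2 : 2 * π * R * ℓ = 2 * (π * R * ℓ) := by ring
    rw [h2] at hs
    rw [hc, h2, Real.cot_eq_cos_div_sin, Real.cot_eq_cos_div_sin]
    rw [Real.sin_two_mul] at hs ⊢
    rw [Real.cos_two_mul]
    have ha : Real.sin (π * R * ℓ) ≠ 0 := fun h => hs (by simp [h])
    have hb : Real.cos (π * R * ℓ) ≠ 0 := fun h => hs (by simp [h])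
    generalize Real.sin (π * R * ℓ) = s at *
    generalize Real.cos (π * R * ℓ) = c at *
    field_simp
    ring
  have hpi := Real.pi_pos
  have hpR : 0 < π * R := by positivity
  refine ⟨h1, fun α ℓ hl hs => by rw [h1 ℓ hl hs], ?_, ?_⟩
  · intro α hα
    have hc : 0 < 2 + α * (π * R) := by
      rw [← neg_div, div_lt_iff₀ hpR] at hα
      linarith
    have hcont : ContinuousOn (fun x : ℝ => 2 * Real.cos x + α * (π * R) * Real.sinc x)
        (Set.Icc 0 π) := by
      have := Real.continuous_sinc
      fun_prop
    obtain ⟨x, ⟨hx0, hx1⟩, hx⟩ := intermediate_value_Ioo' hpi.le hcont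
      (show (0 : ℝ) ∈ _ by
        constructor
        · simp [Real.sinc_of_ne_zero hpi.ne']
        · simpa using hc)
    have hsin := Real.sin_pos_of_pos_of_lt_pi hx0 hx1
    have hxx : π * R * (x / (π * R)) = x := by field_simp
    refine ⟨x / (π * R), ⟨by positivity, ?_⟩, ?_⟩
    · rw [div_lt_div_iff₀ hpR hR]
      nlinarith
    · rw [hxx, Real.cot_eq_cos_div_sin]
      simp only [Real.sinc_of_ne_zero hx0.ne'] at hx
      field_simp at hx ⊢
      linarith
  · intro n hn α
    obtain ⟨m, rfl⟩ : ∃ m, n = m + 1 := ⟨n - 1, by omega⟩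
    have hm : (0 : ℝ) < m := by exact_mod_cast (by omega : 0 < m)
    have hcont : ContinuousOn (fun y : ℝ => 2 * (y + m * π) * Real.cos y
        + α * (π * R) * Real.sin y) (Set.Icc 0 π) := by
      fun_prop
    obtain ⟨y, ⟨hy0, hy1⟩, hy⟩ := intermediate_value_Ioo' hpi.le hcont
      (show (0 : ℝ) ∈ _ by
        have := mul_pos hm hpi
        constructor
        · simp only [Real.cos_pi, Real.sin_pi]; linarith
        · simp only [Real.cos_zero, Real.sin_zero]; linarith)
    have hsin := Real.sin_pos_of_pos_of_lt_pi hy0 hy1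
    have hxx : π * R * ((y + m * π) / (π * R)) = y + m * π := by field_simp
    have hp : ((-1 : ℝ)) ^ m ≠ 0 := by simp
    refine ⟨(y + m * π) / (π * R), ⟨?_, ?_⟩, ?_, ?_⟩
    · rw [div_lt_div_iff₀ hR hpR]
      push_cast
      nlinarith
    · rw [div_lt_div_iff₀ hpR hR]
      push_cast
      nlinarith
    · rw [hxx, Real.sin_add_nat_mul_pi]
      exact mul_ne_zero hp hsin.ne'
    · rw [hxx, Real.cot_eq_cos_div_sin, Real.sin_add_nat_mul_pi, Real.cos_add_nat_mul_pi,
        mul_div_mul_left _ _ hp]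
      simp only at hy
      field_simp
      linarith
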